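/- There exists a constant C > 0 such that for every measurable function f on ℝ^d, Σ_{m∈ℤ^d} ‖f‖_{L^℘(m+𝕢, μ)} ≤ C ‖f‖_{L^℘(μ)}; in particular L^℘(μ) is contained in the amalgam-type space L^℘_*(μ). -/

import Mathlib

open MeasureTheory Metric Set Filter
open scoped ENNReal NNReal BigOperators Topology

noncomputable section

/-- Euclidean space `ℝ^d`. -/
abbrev Euc (d : ℕ) := EuclideanSpace ℝ (Fin d)

/-- A (closed, axis-parallel) cube in `ℝ^d`, given by its center and side length. -/
structure Cube (d : ℕ) where
  center : Euc d
  side : ℝ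

namespace Cube

/-- The underlying set of a cube. -/
def set {d : ℕ} (Q : Cube d) : Set (Euc d) :=
  {y : Euc d | ∀ i, |y i - Q.center i| ≤ Q.side / 2}

/-- The concentric dilate `αQ` of a cube. -/
def dilate {d : ℕ} (Q : Cube d) (α : ℝ) : Cube d := ⟨Q.center, α * Q.side⟩

end Cube

/-- `Q` is a genuine cube for `μ`: positive side length, centered at a point of `supp μ`. -/
def IsCube {d : ℕ} (μ : Measure (Euc d)) (Q : Cube d) : Prop :=
  0 < Q.side ∧ ∀ r : ℝ, 0 < r → 0 < μ (Metric.ball Q.center r)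

/-- The mean value `f_Q = μ(Q)⁻¹ ∫_Q f dμ`. -/
def cubeAvg {d : ℕ} (μ : Measure (Euc d)) (Q : Cube d) (f : Euc d → ℝ) : ℝ :=
  (μ Q.set).toReal⁻¹ * ∫ x in Q.set, f x ∂μ

/-- `N_{Q,R}`: the smallest positive integer `k` with `2^k ℓ(Q) ≥ ℓ(R)`. -/
def NQR {d : ℕ} (Q R : Cube d) : ℕ :=
  sInf {k : ℕ | 0 < k ∧ R.side ≤ 2 ^ k * Q.side}

/-- The Tolsa coefficient `S_{Q,R} = 1 + ∑_{k=1}^{N_{Q,R}} μ(2^k Q)/ℓ(2^k Q)^n`. -/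
def SQR {d : ℕ} (μ : Measure (Euc d)) (n : ℕ) (Q R : Cube d) : ℝ :=
  1 + ∑ k ∈ Finset.Icc 1 (NQR Q R),
      (μ (Q.dilate (2 ^ k)).set).toReal / (2 ^ k * Q.side) ^ n

/-- `Q` is `(α,β)`-doubling: `μ(αQ) ≤ β μ(Q)`. -/
def IsDoubling {d : ℕ} (μ : Measure (Euc d)) (α β : ℝ) (Q : Cube d) : Prop :=
  μ (Q.dilate α).set ≤ ENNReal.ofReal β * μ Q.set

/-- `Q̃ = 2^N Q`, `N` the smallest non-negative integer making `2^N Q` `(ρ,β)`-doubling. -/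
def tilde {d : ℕ} (μ : Measure (Euc d)) (ρ β : ℝ) (Q : Cube d) : Cube d :=
  Q.dilate (2 ^ sInf {N : ℕ | IsDoubling μ ρ β (Q.dilate (2 ^ N))})

/-- `C` is an `RBMO(μ)` bound for `f` (with parameters `η, ρ, β`). -/
def RBMOBound {d : ℕ} (μ : Measure (Euc d)) (n : ℕ) (η ρ β : ℝ)
    (f : Euc d → ℝ) (C : ℝ) : Prop :=
  (∀ Q : Cube d, IsCube μ Q →
      ∫ x in Q.set, |f x - cubeAvg μ (tilde μ ρ β Q) f| ∂μ
        ≤ C * (μ (Q.dilate η).set).toReal) ∧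
  (∀ Q R : Cube d, IsCube μ Q → IsCube μ R → Q.set ⊆ R.set →
      IsDoubling μ ρ β Q → IsDoubling μ ρ β R →
      |cubeAvg μ Q f - cubeAvg μ R f| ≤ C * SQR μ n Q R)

/-- `f ∈ RBMO(μ)`. -/
def MemRBMO {d : ℕ} (μ : Measure (Euc d)) (n : ℕ) (η ρ β : ℝ) (f : Euc d → ℝ) : Prop :=
  LocallyIntegrable f μ ∧ ∃ C : ℝ, 0 ≤ C ∧ RBMOBound μ n η ρ β f C

/-- The `RBMO(μ)` norm of `f`. -/
def rbmoNorm {d : ℕ} (μ : Measure (Euc d)) (n : ℕ) (η ρ β : ℝ) (f : Euc d → ℝ) : ℝ :=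
  sInf {C : ℝ | 0 ≤ C ∧ RBMOBound μ n η ρ β f C}

/-- `C` is an `rbmo(μ)` (local `RBMO`) bound for `f`. -/
def RbmoLocBound {d : ℕ} (μ : Measure (Euc d)) (n : ℕ) (η ρ β : ℝ)
    (f : Euc d → ℝ) (C : ℝ) : Prop :=
  (∀ Q : Cube d, IsCube μ Q → Q.side ≤ 1 →
      ∫ x in Q.set, |f x - cubeAvg μ (tilde μ ρ β Q) f| ∂μ
        ≤ C * (μ (Q.dilate η).set).toReal) ∧
  (∀ Q R : Cube d, IsCube μ Q → IsCube μ R → Q.side ≤ 1 → Q.set ⊆ R.set →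
      IsDoubling μ ρ β Q → IsDoubling μ ρ β R →
      |cubeAvg μ Q f - cubeAvg μ R f| ≤ C * SQR μ n Q R) ∧
  (∀ Q : Cube d, IsCube μ Q → 1 < Q.side →
      ∫ x in Q.set, |f x| ∂μ ≤ C * (μ (Q.dilate η).set).toReal)

/-- `f ∈ rbmo(μ)`. -/
def MemRbmoLoc {d : ℕ} (μ : Measure (Euc d)) (n : ℕ) (η ρ β : ℝ) (f : Euc d → ℝ) : Prop :=
  LocallyIntegrable f μ ∧ ∃ C : ℝ, 0 ≤ C ∧ RbmoLocBound μ n η ρ β f C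

/-- The `rbmo(μ)` norm of `f`. -/
def rbmoLocNorm {d : ℕ} (μ : Measure (Euc d)) (n : ℕ) (η ρ β : ℝ) (f : Euc d → ℝ) : ℝ :=
  sInf {C : ℝ | 0 ≤ C ∧ RbmoLocBound μ n η ρ β f C}

/-- The data of an `∞`-block: `b = ∑ λ_j a_j`, supported in `R`, with `a_j` supported
in `Q_j ⊂ R` and `‖a_j‖_{L^∞(μ)} ≤ (μ(2Q_j) S_{Q_j,R})⁻¹`, `∑_j |λ_j| < ∞`. -/
structure PreBlock {d : ℕ} (μ : Measure (Euc d)) (n : ℕ) : Type where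
  R : Cube d
  Qs : ℕ → Cube d
  lam : ℕ → ℝ
  a : ℕ → Euc d → ℝ
  isCubeR : IsCube μ R
  isCubeQs : ∀ j, IsCube μ (Qs j)
  subsetQR : ∀ j, (Qs j).set ⊆ R.set
  measA : ∀ j, Measurable (a j)
  suppA : ∀ j, Function.support (a j) ⊆ (Qs j).set
  boundA : ∀ j x, |a j x| ≤ ((μ ((Qs j).dilate 2).set).toReal * SQR μ n (Qs j) R)⁻¹
  summable : Summable fun j => |lam j|

/-- The function determined by a block. -/
def PreBlock.fn {d : ℕ} {μ : Measure (Euc d)} {n : ℕ} (b : PreBlock μ n) : Euc d → ℝ :=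
  fun x => ∑' j, b.lam j * b.a j x

/-- `|b| = ∑_j |λ_j|`. -/
def PreBlock.size {d : ℕ} {μ : Measure (Euc d)} {n : ℕ} (b : PreBlock μ n) : ℝ :=
  ∑' j, |b.lam j|

/-- An `∞`-atomic block: an `∞`-block with vanishing integral. -/
structure AtomicBlock {d : ℕ} (μ : Measure (Euc d)) (n : ℕ) extends PreBlock μ n where
  cancel : ∫ x, (∑' j, lam j * a j x) ∂μ = 0

/-- The function determined by an atomic block. -/
def AtomicBlock.fn {d : ℕ} {μ : Measure (Euc d)} {n : ℕ} (b : AtomicBlock μ n) : Euc d → ℝ :=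
  b.toPreBlock.fn

/-- `|b|_{H¹} = ∑_j |λ_j|`. -/
def AtomicBlock.size {d : ℕ} {μ : Measure (Euc d)} {n : ℕ} (b : AtomicBlock μ n) : ℝ :=
  b.toPreBlock.size

/-- The class of test functions `F(x)` of Tolsa's grand maximal function. -/
def TestFun {d : ℕ} (μ : Measure (Euc d)) (n : ℕ) (x : Euc d) (φ : Euc d → ℝ) : Prop :=
  Integrable φ μ ∧ ContDiff ℝ 1 φ ∧ (∫ y, |φ y| ∂μ) ≤ 1 ∧
  (∀ y, 0 ≤ φ y) ∧ (∀ y, y ≠ x → φ y ≤ (‖y - x‖ ^ n)⁻¹) ∧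
  (∀ y, y ≠ x → ‖fderiv ℝ φ y‖ ≤ (‖y - x‖ ^ (n + 1))⁻¹)

/-- The grand maximal function `M f(x) = sup_{φ ∈ F(x)} |∫ f φ dμ|`. -/
def grandM {d : ℕ} (μ : Measure (Euc d)) (n : ℕ) (f : Euc d → ℝ) (x : Euc d) : ℝ :=
  sSup {r : ℝ | ∃ φ : Euc d → ℝ, TestFun μ n x φ ∧ r = |∫ y, f y * φ y ∂μ|}

/-- The local class `F_loc(x)`: test functions supported in the cube `Q(x,1)`. -/
def TestFunLoc {d : ℕ} (μ : Measure (Euc d)) (n : ℕ) (x : Euc d) (φ : Euc d → ℝ) : Prop :=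
  TestFun μ n x φ ∧ Function.support φ ⊆ (Cube.mk x 1).set

/-- The local grand maximal function `M^{(1)} f(x) = sup_{φ ∈ F_loc(x)} |∫ f φ dμ|`. -/
def grandMLoc {d : ℕ} (μ : Measure (Euc d)) (n : ℕ) (f : Euc d → ℝ) (x : Euc d) : ℝ :=
  sSup {r : ℝ | ∃ φ : Euc d → ℝ, TestFunLoc μ n x φ ∧ r = |∫ y, f y * φ y ∂μ|}

/-- The Orlicz quasi-norm of `u` on the set `E`, for the Orlicz function `P`
(with value `∞` when no admissible constant exists). -/
def orliczNormOn {α : Type*} [MeasurableSpace α] (P : ℝ → ℝ) (lam : Measure α)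
    (E : Set α) (u : α → ℝ) : ℝ≥0∞ :=
  sInf {k : ℝ≥0∞ | 0 < k ∧ k ≠ ∞ ∧
    ∫⁻ x in E, ENNReal.ofReal (P (|u x| / k.toReal)) ∂lam ≤ 1}

/-- The Orlicz quasi-norm of `u`. -/
def orliczNorm {α : Type*} [MeasurableSpace α] (P : ℝ → ℝ) (lam : Measure α)
    (u : α → ℝ) : ℝ≥0∞ :=
  orliczNormOn P lam Set.univ u

/-- `℘(t) = t / log(e+t)`. -/
def wp (t : ℝ) : ℝ := t / Real.log (Real.exp 1 + t)

/-- `℘̃(t) = t · log(e+t)`. -/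
def wpDual (t : ℝ) : ℝ := t * Real.log (Real.exp 1 + t)

/-- `Ξ(t) = e^t − 1`. -/
def XiFun (t : ℝ) : ℝ := Real.exp t - 1

/-- `dν(x) = dμ(x)/log(e+|x|)`. -/
def nuMeas {d : ℕ} (μ : Measure (Euc d)) : Measure (Euc d) :=
  μ.withDensity fun x => ENNReal.ofReal (Real.log (Real.exp 1 + ‖x‖))⁻¹

/-- `dσ(x) = dμ(x)/(1+|x|)^{2n+κ}`. -/
def sigmaMeas {d : ℕ} (μ : Measure (Euc d)) (n : ℕ) (κ : ℝ) : Measure (Euc d) :=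
  μ.withDensity fun x => ENNReal.ofReal (((1 + ‖x‖) ^ (2 * (n : ℝ) + κ))⁻¹)

/-- The unit cube `m + [0,1)^d` of the lattice `ℤ^d`. -/
def latCube (d : ℕ) (m : Fin d → ℤ) : Set (Euc d) :=
  {x : Euc d | ∀ i, (m i : ℝ) ≤ x i ∧ x i < (m i : ℝ) + 1}

lemma one_le_log_exp_one_add {t : ℝ} (ht : 0 ≤ t) : 1 ≤ Real.log (Real.exp 1 + t) := by
  rw [Real.le_log_iff_exp_le (by positivity)]
  linarith

lemma wp_div_le {t b : ℝ} (ht : 0 ≤ t) (hb : 0 < b) (hb1 : b ≤ 1) :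
    wp (t / b) ≤ b⁻¹ * wp t := by
  have hle : t ≤ t / b := le_div_self ht hb hb1
  have hlog := one_le_log_exp_one_add ht
  have hlog_le : Real.log (Real.exp 1 + t) ≤ Real.log (Real.exp 1 + t / b) :=
    Real.log_le_log (by positivity) (by linarith)
  calc wp (t / b) ≤ t / b / Real.log (Real.exp 1 + t) :=
        div_le_div_of_nonneg_left (by positivity) (by linarith) hlog_le
    _ = b⁻¹ * wp t := by unfold wp; ring

/-- On any set, the `℘`-quasi-norm is at most `k` times the modular at scale `k`,
once the latter is at most `1`. -/
lemma orliczNormOn_wp_le {α : Type*} [MeasurableSpace α] (lam : Measure α) (E : Set α)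
    (u : α → ℝ) {k : ℝ≥0∞} (hk : 0 < k) (hk' : k ≠ ∞)
    (hE : ∫⁻ x in E, ENNReal.ofReal (wp (|u x| / k.toReal)) ∂lam ≤ 1) :
    orliczNormOn wp lam E u
      ≤ k * ∫⁻ x in E, ENNReal.ofReal (wp (|u x| / k.toReal)) ∂lam := by
  set a := ∫⁻ x in E, ENNReal.ofReal (wp (|u x| / k.toReal)) ∂lam
  refine le_of_forall_gt_imp_ge_of_dense fun c hc => ?_
  set b := min 1 (c / k)
  have hb0 : 0 < b := lt_min one_pos (ENNReal.div_pos (pos_of_gt hc).ne' hk')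
  have hb1 : b ≤ 1 := min_le_left _ _
  have hbt : b ≠ ∞ := ne_top_of_le_ne_top ENNReal.one_ne_top hb1
  have hab : a ≤ b := by
    refine le_min hE ?_
    rw [ENNReal.le_div_iff_mul_le (Or.inl hk.ne') (Or.inl hk'), mul_comm]
    exact hc.le
  have hkb : k * b ≤ c :=
    (mul_le_mul_right (min_le_right _ _) k).trans ENNReal.mul_div_le
  have hbr : 0 < b.toReal := ENNReal.toReal_pos hb0.ne' hbt
  have hbr1 : b.toReal ≤ 1 := ENNReal.toReal_le_of_le_ofReal one_pos.le (by simpa using hb1)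
  refine le_trans (sInf_le ?_) hkb
  refine ⟨ENNReal.mul_pos hk.ne' hb0.ne', ENNReal.mul_ne_top hk' hbt, ?_⟩
  calc ∫⁻ x in E, ENNReal.ofReal (wp (|u x| / (k * b).toReal)) ∂lam
      ≤ ∫⁻ x in E, b⁻¹ * ENNReal.ofReal (wp (|u x| / k.toReal)) ∂lam := by
        refine lintegral_mono fun x => ?_
        have h := wp_div_le (t := |u x| / k.toReal) (by positivity) hbr hbr1
        rw [div_div, ← ENNReal.toReal_mul] at h
        refine (ENNReal.ofReal_le_ofReal h).trans_eq ?_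
        rw [ENNReal.ofReal_mul (by positivity), ENNReal.ofReal_inv_of_pos hbr,
          ENNReal.ofReal_toReal hbt]
    _ = b⁻¹ * a := lintegral_const_mul' _ _ (ENNReal.inv_ne_top.2 hb0.ne')
    _ ≤ b⁻¹ * b := mul_le_mul_right hab _
    _ = 1 := ENNReal.inv_mul_cancel hb0.ne' hbt

lemma tsum_orliczNormOn_wp_le {α ι : Type*} [MeasurableSpace α] [Countable ι] (lam : Measure α)
    {s : ι → Set α} (hs : ∀ i, MeasurableSet (s i)) (hd : Pairwise (Function.onFun Disjoint s))
    (u : α → ℝ) : ∑' i, orliczNormOn wp lam (s i) u ≤ orliczNorm wp lam u := by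
  refine le_sInf fun k ⟨hk, hk', hint⟩ => ?_
  calc ∑' i, orliczNormOn wp lam (s i) u
      ≤ ∑' i, k * ∫⁻ x in s i, ENNReal.ofReal (wp (|u x| / k.toReal)) ∂lam :=
        ENNReal.tsum_le_tsum fun i => orliczNormOn_wp_le lam (s i) u hk hk'
          ((lintegral_mono_set (subset_univ _)).trans hint)
    _ = k * ∫⁻ x in ⋃ i, s i, ENNReal.ofReal (wp (|u x| / k.toReal)) ∂lam := by
        rw [ENNReal.tsum_mul_left, lintegral_iUnion hs hd]
    _ ≤ k * 1 := mul_le_mul_right ((lintegral_mono_set (subset_univ _)).trans hint) k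
    _ = k := mul_one k

lemma measurableSet_latCube (d : ℕ) (m : Fin d → ℤ) : MeasurableSet (latCube d m) := by
  unfold latCube
  measurability

lemma pairwise_disjoint_latCube (d : ℕ) : Pairwise (Function.onFun Disjoint (latCube d)) := by
  intro m m' hne
  refine Set.disjoint_left.2 fun x hx hx' => hne (funext fun i => ?_)
  rw [← Int.floor_eq_iff.2 (hx i), ← Int.floor_eq_iff.2 (hx' i)]

/-- `∑_{m ∈ ℤ^d} ‖f‖_{L^℘(m+𝕢,μ)} ≤ C ‖f‖_{L^℘(μ)}`; in particular
`L^℘(μ)` embeds in the amalgam-type space `L^℘_*(μ)`. -/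
theorem wp_amalgam_embedding
    {d n : ℕ} (μ : Measure (Euc d)) (C₀ : ℝ)
    (hn : 0 < n) (hnd : n ≤ d) (hC₀ : 0 < C₀)
    (hgrowth : ∀ x : Euc d, ∀ r : ℝ, 0 < r →
      μ (Metric.ball x r) ≤ ENNReal.ofReal (C₀ * r ^ n)) :
    ∃ C : ℝ, 0 < C ∧
      ∀ f : Euc d → ℝ, Measurable f →
        ∑' m : Fin d → ℤ, orliczNormOn wp μ (latCube d m) f
          ≤ ENNReal.ofReal C * orliczNorm wp μ f := by
  exact ⟨1, one_pos, fun f _ => by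
    simpa using tsum_orliczNormOn_wp_le μ (measurableSet_latCube d)
      (pairwise_disjoint_latCube d) f⟩
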